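/- arXiv:1907.08762 — 2 statements merged into one kernel-verified Lean document; each statement's English description precedes it below -/
import Mathlib

section
/- If X is an L-Tychonoff topological space and every pseudocompact subset of X is contained in some Lindelöf subset of X, then X is Ps-Tychonoff. -/
open Set Topology Filter

universe u v

/-- A subset `K` of a topological space is pseudocompact if every continuous
real-valued function on `K` (with the subspace topology) is bounded. -/
def IsPseudocompactSet {X : Type u} [TopologicalSpace X] (K : Set X) : Prop :=
  ∀ f : K → ℝ, Continuous f → ∃ M : ℝ, ∀ x : K, |f x| ≤ M

/-- A subset `K` is countably compact if every countable open cover of `K`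
has a finite subcover. -/
def IsCountablyCompactSet {X : Type u} [TopologicalSpace X] (K : Set X) : Prop :=
  ∀ U : ℕ → Set X, (∀ n, IsOpen (U n)) → K ⊆ ⋃ n, U n →
    ∃ t : Finset ℕ, K ⊆ ⋃ n ∈ t, U n

/-- `f` restricts to a homeomorphism of `K` onto `f '' K`
(both with their subspace topologies). -/
def RestrictsToHomeo {X : Type u} {Y : Type v} [TopologicalSpace X] [TopologicalSpace Y]
    (f : X → Y) (K : Set X) : Prop :=
  ∃ e : K ≃ₜ (f '' K), ∀ x : K, (e x : Y) = f x

/-- `X` is Ps-normal. -/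
def PsNormal (X : Type u) [TopologicalSpace X] : Prop :=
  ∃ (Y : Type u) (_ : TopologicalSpace Y) (f : X → Y), NormalSpace Y ∧
    Function.Bijective f ∧ ∀ K : Set X, IsPseudocompactSet K → RestrictsToHomeo f K

/-- `X` is CC-normal. -/
def CCNormal (X : Type u) [TopologicalSpace X] : Prop :=
  ∃ (Y : Type u) (_ : TopologicalSpace Y) (f : X → Y), NormalSpace Y ∧
    Function.Bijective f ∧ ∀ K : Set X, IsCountablyCompactSet K → RestrictsToHomeo f K

/-- `X` is C-normal. -/
def CNormal (X : Type u) [TopologicalSpace X] : Prop :=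
  ∃ (Y : Type u) (_ : TopologicalSpace Y) (f : X → Y), NormalSpace Y ∧
    Function.Bijective f ∧ ∀ K : Set X, IsCompact K → RestrictsToHomeo f K

/-- `X` is Ps-Tychonoff. -/
def PsTychonoff (X : Type u) [TopologicalSpace X] : Prop :=
  ∃ (Y : Type u) (_ : TopologicalSpace Y) (f : X → Y), T35Space Y ∧
    Function.Bijective f ∧ ∀ K : Set X, IsPseudocompactSet K → RestrictsToHomeo f K

/-- `X` is C-Tychonoff. -/
def CTychonoff (X : Type u) [TopologicalSpace X] : Prop :=
  ∃ (Y : Type u) (_ : TopologicalSpace Y) (f : X → Y), T35Space Y ∧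
    Function.Bijective f ∧ ∀ K : Set X, IsCompact K → RestrictsToHomeo f K

/-- `X` is L-Tychonoff. -/
def LTychonoff (X : Type u) [TopologicalSpace X] : Prop :=
  ∃ (Y : Type u) (_ : TopologicalSpace Y) (f : X → Y), T35Space Y ∧
    Function.Bijective f ∧ ∀ K : Set X, IsLindelof K → RestrictsToHomeo f K

theorem restrictsToHomeo_iff_isEmbedding {X : Type u} {Y : Type v} [TopologicalSpace X]
    [TopologicalSpace Y] {f : X → Y} {K : Set X} :
    RestrictsToHomeo f K ↔ IsEmbedding (K.domRestrict f) := by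
  constructor
  · rintro ⟨e, he⟩
    have h : K.domRestrict f = Subtype.val ∘ e := funext fun x => (he x).symm
    rw [h]
    exact IsEmbedding.subtypeVal.comp e.isEmbedding
  · intro h
    exact ⟨h.toHomeomorph.trans (Homeomorph.setCongr (Set.range_domRestrict f K)), fun _ => rfl⟩

theorem RestrictsToHomeo.mono {X : Type u} {Y : Type v} [TopologicalSpace X]
    [TopologicalSpace Y] {f : X → Y} {K A : Set X} (h : RestrictsToHomeo f A) (hKA : K ⊆ A) :
    RestrictsToHomeo f K :=
  restrictsToHomeo_iff_isEmbedding.2 <|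
    (restrictsToHomeo_iff_isEmbedding.1 h).comp (IsEmbedding.inclusion hKA)

/-- If `X` is L-Tychonoff and every pseudocompact subset of `X` is contained in some
Lindelöf subset of `X`, then `X` is Ps-Tychonoff. -/
theorem lTychonoff_isPsTychonoff {X : Type u} [TopologicalSpace X] (h : LTychonoff X)
    (hc : ∀ K : Set X, IsPseudocompactSet K → ∃ A : Set X, IsLindelof A ∧ K ⊆ A) :
    PsTychonoff X := by
  obtain ⟨Y, _, f, hY, hf, hL⟩ := h
  refine ⟨Y, _, f, hY, hf, fun K hK => ?_⟩
  obtain ⟨A, hA, hKA⟩ := hc K hK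
  exact (hL A hA).mono hKA
end

section
/- If X is a C-Tychonoff and Fréchet topological space, then for every compact subset A of X and every point x of X with x ∉ A, there exists a continuous function h : X → [0,1] such that h(x) = 0 and h(a) = 1 for all a ∈ A. -/
open Set Topology Filter

universe u v

/-- A map restricting to a homeomorphism of `K` onto its image is continuous on `K`. -/
lemma RestrictsToHomeo.continuousOn {X : Type u} {Y : Type v} [TopologicalSpace X]
    [TopologicalSpace Y] {f : X → Y} {K : Set X} (h : RestrictsToHomeo f K) :
    ContinuousOn f K := by
  obtain ⟨e, he⟩ := h
  rw [continuousOn_iff_continuous_domRestrict]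
  exact (continuous_subtype_val.comp e.continuous).congr he

/-- On a sequential space, a map that is continuous on every compact set is continuous. -/
lemma continuous_of_continuousOn_isCompact {X : Type u} {Y : Type v} [TopologicalSpace X]
    [SequentialSpace X] [TopologicalSpace Y] {f : X → Y}
    (h : ∀ K : Set X, IsCompact K → ContinuousOn f K) : Continuous f := by
  rw [continuous_iff_seqContinuous]
  intro u a hu
  have hc := h _ hu.isCompact_insert_range a (mem_insert a _)
  exact hc.tendsto.comp (tendsto_nhdsWithin_iff.2
    ⟨hu, Eventually.of_forall fun n => mem_insert_of_mem _ (mem_range_self n)⟩)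

/-- In a C-Tychonoff Fréchet space, points can be separated from compact sets by
continuous `[0,1]`-valued functions. -/
theorem cTychonoff_frechet_separation {X : Type u} [TopologicalSpace X]
    [FrechetUrysohnSpace X] (hX : CTychonoff X) (A : Set X) (hA : IsCompact A)
    (x : X) (hx : x ∉ A) :
    ∃ h : C(X, unitInterval), h x = 0 ∧ ∀ a ∈ A, h a = 1 := by
  obtain ⟨Y, _, f, _, hf, hK⟩ := hX
  have hfc : Continuous f :=
    continuous_of_continuousOn_isCompact fun K hKc => (hK K hKc).continuousOn
  have hfx : f x ∉ f '' A := fun h => hx ((hf.injective.mem_set_image).1 h)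
  obtain ⟨g, hg, hg0, hg1⟩ :=
    CompletelyRegularSpace.completely_regular (f x) (f '' A) (hA.image hfc).isClosed hfx
  exact ⟨⟨g ∘ f, hg.comp hfc⟩, hg0, fun a ha => hg1 (mem_image_of_mem f ha)⟩
end
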